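/- The quadruple product detects Cayley planes: for every orthonormal quadruple (f₁,f₂,f₃,f₄) of vectors in ℝ⁸, the alternating 2-form f₁ × (f₂×f₃×f₄) is zero if and only if Φ₀(f₁,f₂,f₃,f₄)² = 1. (On an orthonormal frame the quadruple product τ(f₁,f₂,f₃,f₄) = f₁×(f₂×f₃×f₄) − g(f₁,f₂)(f₃×f₄) − … reduces to its first term f₁×(f₂×f₃×f₄), so this says a 4-plane is calibrated by ±Φ₀ exactly when τ vanishes on it.) -/

import Mathlib

open scoped BigOperators RealInnerProductSpace

noncomputable section

/-- ℝ⁸ with its Euclidean inner product. -/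
abbrev V8 : Type := EuclideanSpace ℝ (Fin 8)

/-- The standard orthonormal basis vectors e₁, …, e₈ of ℝ⁸ (indexed by `Fin 8`). -/
def e (i : Fin 8) : V8 := EuclideanSpace.single i (1 : ℝ)

/-- The alternating 4-form `dxᵢ ∧ dxⱼ ∧ dx_k ∧ dx_l` on ℝ⁸. -/
def dxQ (i j k l : Fin 8) : AlternatingMap ℝ V8 ℝ (Fin 4) :=
  (Matrix.detRowAlternating : AlternatingMap ℝ (Fin 4 → ℝ) ℝ (Fin 4)).compLinearMap
    (LinearMap.pi fun a : Fin 4 =>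
      ((EuclideanSpace.proj (![i, j, k, l] a) : V8 →L[ℝ] ℝ) : V8 →ₗ[ℝ] ℝ))

/-- The standard Cayley form Φ₀ on ℝ⁸. -/
def Phi0 : AlternatingMap ℝ V8 ℝ (Fin 4) :=
  dxQ 0 1 2 3 - dxQ 0 1 4 5 - dxQ 0 1 6 7 - dxQ 0 2 4 6 + dxQ 0 2 5 7 -
    dxQ 0 3 4 7 - dxQ 0 3 5 6 - dxQ 1 2 4 7 - dxQ 1 2 5 6 + dxQ 1 3 4 6 -
    dxQ 1 3 5 7 - dxQ 2 3 4 5 - dxQ 2 3 6 7 + dxQ 4 5 6 7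

/-- The alternating 2-form `(x, y) ↦ Φ₀(u, v, x, y)`. -/
def iotaPhi (u v : V8) : AlternatingMap ℝ V8 ℝ (Fin 2) :=
  (Phi0.curryLeft u).curryLeft v

/-- The wedge `u♭ ∧ v♭`, i.e. the alternating 2-form `(x,y) ↦ ⟨u,x⟩⟨v,y⟩ − ⟨u,y⟩⟨v,x⟩`. -/
def wedgeF (u v : V8) : AlternatingMap ℝ V8 ℝ (Fin 2) :=
  (Matrix.detRowAlternating : AlternatingMap ℝ (Fin 2 → ℝ) ℝ (Fin 2)).compLinearMap
    (LinearMap.pi fun a : Fin 2 =>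
      ((![innerSL ℝ u, innerSL ℝ v] a : V8 →L[ℝ] ℝ) : V8 →ₗ[ℝ] ℝ))

/-- The cross product `u×v = ¼(u♭∧v♭ − ι(u)ι(v)Φ₀)`, explicitly
`(u×v)(x,y) = ¼(⟨u,x⟩⟨v,y⟩ − ⟨u,y⟩⟨v,x⟩ + Φ₀(u,v,x,y))`. -/
def cross (u v : V8) : AlternatingMap ℝ V8 ℝ (Fin 2) :=
  ((4 : ℝ)⁻¹) • (wedgeF u v + iotaPhi u v)

/-- The triple product `u×v×w = (ι(u)ι(v)ι(w)Φ₀)^♯`, i.e. the unique vector with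
`⟨u×v×w, x⟩ = Φ₀(u,v,w,x)` for all `x`. -/
def tripleProd (u v w : V8) : V8 :=
  ∑ i : Fin 8, Phi0 ![u, v, w, e i] • e i

/-- The `3 × 3` minor of `(u, v, w)` in the coordinates `a, b, c`. -/
def minor (u v w : V8) (a b c : Fin 8) : ℝ :=
  u a * (v b * w c - v c * w b) - u b * (v a * w c - v c * w a) + u c * (v a * w b - v b * w a)

lemma dxQ_eq_det (i j k l : Fin 8) (x : Fin 4 → V8) :
    dxQ i j k l x = (Matrix.of fun a b : Fin 4 => x a (![i, j, k, l] b)).det := by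
  rfl

lemma dxQ_apply (i j k l : Fin 8) (u v w x : V8) :
    dxQ i j k l ![u, v, w, x] =
      x l * minor u v w i j k - x k * minor u v w i j l + x j * minor u v w i k l -
        x i * minor u v w j k l := by
  rw [dxQ_eq_det, Matrix.det_succ_row_zero]
  simp [Fin.sum_univ_succ, Matrix.det_fin_three, Fin.succAbove, minor]
  ring

lemma inner_e (v : V8) (i : Fin 8) : ⟪v, e i⟫ = v i := by
  simp [e, EuclideanSpace.inner_single_right]

lemma map_eq_sum_last (Φ : AlternatingMap ℝ V8 ℝ (Fin 4)) (u v w x : V8) :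
    Φ ![u, v, w, x] = ∑ i : Fin 8, x i * Φ ![u, v, w, e i] := by
  have hx : x = ∑ i : Fin 8, x i • e i := by
    ext j
    simp [e, Finset.sum_apply, Pi.single_apply]
  have hupd : ∀ y : V8, Function.update ![u, v, w, 0] 3 y = ![u, v, w, y] := by
    intro y
    ext a : 1
    fin_cases a <;> rfl
  rw [← hupd]
  conv_lhs => rw [hx, Φ.map_update_sum]
  refine Finset.sum_congr rfl fun i _ => ?_
  rw [Φ.map_update_smul, hupd, smul_eq_mul]

lemma inner_tripleProd (u v w x : V8) : ⟪tripleProd u v w, x⟫ = Phi0 ![u, v, w, x] := by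
  rw [tripleProd, sum_inner, map_eq_sum_last]
  refine Finset.sum_congr rfl fun i _ => ?_
  rw [real_inner_smul_left, real_inner_comm, inner_e, mul_comm]

lemma tripleProd_apply (u v w : V8) (i : Fin 8) :
    tripleProd u v w i = Phi0 ![u, v, w, e i] := by
  rw [← inner_tripleProd, inner_e]

set_option maxHeartbeats 4000000 in
lemma inner_tripleProd_self (u v w : V8) :
    ⟪tripleProd u v w, tripleProd u v w⟫ =
      ⟪u, u⟫ * (⟪v, v⟫ * ⟪w, w⟫ - ⟪v, w⟫ ^ 2) - ⟪u, v⟫ * (⟪u, v⟫ * ⟪w, w⟫ - ⟪v, w⟫ * ⟪u, w⟫) +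
        ⟪u, w⟫ * (⟪u, v⟫ * ⟪v, w⟫ - ⟪v, v⟫ * ⟪u, w⟫) := by
  have he : ∀ i j : Fin 8, e i j = if j = i then 1 else 0 := by
    intro i j
    simp [e]
  simp only [PiLp.inner_apply, RCLike.inner_apply, conj_trivial, tripleProd_apply,
    Fin.sum_univ_eight]
  simp only [Phi0, AlternatingMap.add_apply, AlternatingMap.sub_apply, dxQ_apply, he]
  simp only [Fin.reduceEq, if_true, if_false, zero_mul, one_mul, sub_zero, zero_sub, add_zero,
    zero_add, minor]
  ring

lemma cross_apply_pair (u v x y : V8) :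
    cross u v ![x, y] = 4⁻¹ * (⟪u, x⟫ * ⟪v, y⟫ - ⟪u, y⟫ * ⟪v, x⟫ + Phi0 ![u, v, x, y]) := by
  have h : wedgeF u v ![x, y] =
      Matrix.det (Matrix.of fun a b : Fin 2 => (![innerSL ℝ u, innerSL ℝ v] b) (![x, y] a)) := rfl
  have h' : iotaPhi u v ![x, y] = Phi0 ![u, v, x, y] := by
    rw [iotaPhi, AlternatingMap.curryLeft_apply_apply, AlternatingMap.curryLeft_apply_apply]
  rw [cross, AlternatingMap.smul_apply, AlternatingMap.add_apply, h, h', Matrix.det_fin_two]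
  simp
  ring

lemma cross_pair_self (u v : V8) :
    cross u v ![u, v] = 4⁻¹ * (⟪u, u⟫ * ⟪v, v⟫ - ⟪u, v⟫ ^ 2) := by
  have h : Phi0 ![u, v, u, v] = 0 :=
    Phi0.map_eq_zero_of_eq _ (i := 0) (j := 2) rfl (by decide)
  rw [cross_apply_pair, h, real_inner_comm u v]
  ring

lemma cross_smul_self (c : ℝ) (u : V8) : cross u (c • u) = 0 := by
  ext z
  have hz : z = ![z 0, z 1] := by
    ext a : 1
    fin_cases a <;> rfl
  have h : ∀ x y : V8, Phi0 ![u, c • u, x, y] = 0 := by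
    intro x y
    have hu : (![u, c • u, x, y] : Fin 4 → V8) = Function.update ![u, u, x, y] 1 (c • u) := by
      ext a : 1
      fin_cases a <;> rfl
    have h0 : Phi0 ![u, u, x, y] = 0 :=
      Phi0.map_eq_zero_of_eq _ (i := 0) (j := 1) rfl (by decide)
    have hid : Function.update (![u, u, x, y] : Fin 4 → V8) 1 u = ![u, u, x, y] := by
      ext a : 1
      fin_cases a <;> rfl
    rw [hu, Phi0.map_update_smul, hid, h0, smul_zero]
  rw [hz, cross_apply_pair, h]
  simp only [real_inner_smul_left, AlternatingMap.zero_apply]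
  ring

/-- **The quadruple product detects Cayley planes:** for an orthonormal quadruple
`(f₁,f₂,f₃,f₄)` in ℝ⁸ the alternating 2-form `f₁ × (f₂×f₃×f₄)` (which is the quadruple
product `τ(f₁,f₂,f₃,f₄)` on an orthonormal frame) vanishes iff `Φ₀(f₁,f₂,f₃,f₄)² = 1`. -/
theorem quadProd_detects_cayley (f : Fin 4 → V8) (hf : Orthonormal ℝ f) :
    cross (f 0) (tripleProd (f 1) (f 2) (f 3)) = 0 ↔ (Phi0 f) ^ 2 = 1 := by
  have hn : ∀ i, ⟪f i, f i⟫ = 1 := fun i => by simp [hf.1 i]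
  have ho : ∀ i j, i ≠ j → ⟪f i, f j⟫ = 0 := fun i j hij => hf.2 hij
  set w := tripleProd (f 1) (f 2) (f 3) with hw
  have hww : ⟪w, w⟫ = 1 := by
    rw [hw, inner_tripleProd_self, ho 1 2 (by decide), ho 1 3 (by decide), ho 2 3 (by decide)]
    simp only [hn]
    norm_num
  have hwu : ⟪f 0, w⟫ ^ 2 = Phi0 f ^ 2 := by
    have hperm : (![f 1, f 2, f 3, f 0] : Fin 4 → V8) = f ∘ finRotate 4 := by
      ext a : 1
      fin_cases a <;> rfl
    have hsign : Equiv.Perm.sign (finRotate 4) = -1 := by decide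
    rw [real_inner_comm, hw, inner_tripleProd, hperm, AlternatingMap.map_perm, hsign]
    simp
  rw [← hwu]
  constructor
  · intro h
    have h1 : cross (f 0) w ![f 0, w] = 0 := by simp [h]
    rw [cross_pair_self, hn, hww] at h1
    linarith
  · intro h
    have hsub : w - ⟪f 0, w⟫ • f 0 = 0 := by
      rw [← inner_self_eq_zero (𝕜 := ℝ)]
      simp only [inner_sub_left, inner_sub_right, real_inner_smul_left, real_inner_smul_right, hn,
        hww, real_inner_comm (f 0) w]
      linarith
    rw [sub_eq_zero.1 hsub]
    exact cross_smul_self _ _
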